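/- Let C be a left-cancellative category that is right-Noetherian and in which any two morphisms with the same source that admit a common right-multiple admit a right-lcm. Then a subfamily S of the morphisms of C is a Garside family if and only if S♯ generates C and S♯ is closed under right-lcm and closed under right-divisor. -/

import Mathlib

open CategoryTheory

universe u v

namespace GarsideTest

variable {C : Type u} [Category.{v} C]

/-- `C` is left-cancellative. -/
def LeftCancellative (C : Type u) [Category.{v} C] : Prop :=
  ∀ ⦃x y z : C⦄ (f : x ⟶ y) (g g' : y ⟶ z), f ≫ g = f ≫ g' → g = g'

/-- `f` left-divides `g`. -/
def LDiv {x y z : C} (f : x ⟶ y) (g : x ⟶ z) : Prop :=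
  ∃ r : y ⟶ z, f ≫ r = g

/-- `f` properly left-divides `g` (`f ⊏ g`). -/
def LDivStrict {x y z : C} (f : x ⟶ y) (g : x ⟶ z) : Prop :=
  LDiv f g ∧ ¬ LDiv g f

/-- `f =× g` : `g` is obtained from `f` by right-multiplication by an invertible element. -/
def EqIr {x y z : C} (f : x ⟶ y) (g : x ⟶ z) : Prop :=
  ∃ e : y ⟶ z, IsIso e ∧ f ≫ e = g

/-- The family `S♯ = S C× ∪ C×`. -/
def Sharp (S : MorphismProperty C) : MorphismProperty C :=
  fun x z g =>
    (∃ (y : C) (s : x ⟶ y) (e : y ⟶ z), S s ∧ IsIso e ∧ s ≫ e = g) ∨ IsIso g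

/-- Composable paths of morphisms of `C`. -/
inductive Path {C : Type u} [Category.{v} C] : C → C → Type (max u v)
  | nil (x : C) : Path x x
  | cons {x y z : C} (g : x ⟶ y) (p : Path y z) : Path x z

namespace Path

/-- The composite of a path. -/
def comp : ∀ {x z : C}, Path x z → (x ⟶ z)
  | _, _, nil x => 𝟙 x
  | _, _, cons g p => g ≫ p.comp

/-- The length of a path. -/
def length : ∀ {x z : C}, Path x z → ℕ
  | _, _, nil _ => 0
  | _, _, cons _ p => p.length + 1

/-- All entries of the path lie in `T`. -/
def Entries (T : MorphismProperty C) : ∀ {x z : C}, Path x z → Prop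
  | _, _, nil _ => True
  | _, _, cons g p => T g ∧ Entries T p

/-- Concatenation of paths. -/
def append : ∀ {x y z : C}, Path x y → Path y z → Path x z
  | _, _, _, nil _, q => q
  | _, _, _, cons g p, q => cons g (p.append q)

open scoped Classical in
/-- Number of non-invertible entries of a path. -/
noncomputable def ninv : ∀ {x z : C}, Path x z → ℕ
  | _, _, nil _ => 0
  | _, _, cons g p => (if IsIso g then 0 else 1) + p.ninv

end Path

/-- The length-two path `(g₁, g₂)` is `S`-greedy. -/
def Greedy2 (S : MorphismProperty C) {x y z : C} (g₁ : x ⟶ y) (g₂ : y ⟶ z) : Prop :=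
  ∀ ⦃u w : C⦄ (f : u ⟶ x) (h : u ⟶ w), S h → LDiv h (f ≫ g₁ ≫ g₂) → LDiv h (f ≫ g₁)

/-- Auxiliary: the path `g :: p` is `S`-greedy. -/
def Path.GreedyFrom (S : MorphismProperty C) : ∀ {x y z : C}, (x ⟶ y) → Path y z → Prop
  | _, _, _, _, .nil _ => True
  | _, _, _, g, .cons g' p => Greedy2 S g g' ∧ Path.GreedyFrom S g' p

/-- The path `p` is `S`-greedy. -/
def Path.Greedy (S : MorphismProperty C) : ∀ {x z : C}, Path x z → Prop
  | _, _, .nil _ => True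
  | _, _, .cons g p => Path.GreedyFrom S g p

/-- The path `p` is `S`-normal: `S`-greedy with entries in `S♯`. -/
def Path.Normal (S : MorphismProperty C) {x z : C} (p : Path x z) : Prop :=
  p.Greedy S ∧ p.Entries (Sharp S)

/-- `p` is an `S`-normal decomposition of the morphism `g`. -/
def IsNormalDecomp (S : MorphismProperty C) {x z : C} (g : x ⟶ z) (p : Path x z) : Prop :=
  p.Normal S ∧ p.comp = g

/-- `X` generates `C`. -/
def Generates (X : MorphismProperty C) : Prop :=
  ∀ ⦃x z : C⦄ (g : x ⟶ z), ∃ p : Path x z, p.Entries X ∧ p.comp = g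

/-- `S` is a Garside family in `C`. -/
def IsGarside (S : MorphismProperty C) : Prop :=
  ∀ ⦃x z : C⦄ (g : x ⟶ z), ∃ p : Path x z, IsNormalDecomp S g p

/-- `Xʳ`: morphisms expressible as composites of `r` elements of `X`. -/
def MPow (X : MorphismProperty C) (r : ℕ) : MorphismProperty C :=
  fun x z g => ∃ p : Path x z, p.Entries X ∧ p.length = r ∧ p.comp = g

/-- `X` is closed under right-complement. -/
def ClosedUnderRightComplement (X : MorphismProperty C) : Prop :=
  ∀ ⦃x y y' z : C⦄ (f : x ⟶ y) (g : x ⟶ y') (h : x ⟶ z), X f → X g →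
    LDiv f h → LDiv g h →
    ∃ (w : C) (g' : y ⟶ w) (f' : y' ⟶ w),
      X g' ∧ X f' ∧ f ≫ g' = g ≫ f' ∧ LDiv (f ≫ g') h

/-- `X` is closed under right-comultiple. -/
def ClosedUnderRightComultiple (X : MorphismProperty C) : Prop :=
  ∀ ⦃x y y' z : C⦄ (f : x ⟶ y) (g : x ⟶ y') (h : x ⟶ z), X f → X g →
    LDiv f h → LDiv g h →
    ∃ (w : C) (h' : x ⟶ w), X h' ∧ LDiv f h' ∧ LDiv g h' ∧ LDiv h' h

/-- `X` is closed under right-divisor. -/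
def ClosedUnderRightDivisor (X : MorphismProperty C) : Prop :=
  ∀ ⦃x y z : C⦄ (f : x ⟶ y) (g : y ⟶ z), X (f ≫ g) → X g

/-- `g₁` is an `S`-head of `g`. -/
def IsHead (S : MorphismProperty C) {x w y : C} (g₁ : x ⟶ w) (g : x ⟶ y) : Prop :=
  S g₁ ∧ LDiv g₁ g ∧ ∀ ⦃w' : C⦄ (h : x ⟶ w'), S h → LDiv h g → LDiv h g₁

/-- `h` is a right-lcm of `f` and `g`. -/
def IsRightLcm {x y y' w : C} (f : x ⟶ y) (g : x ⟶ y') (h : x ⟶ w) : Prop :=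
  LDiv f h ∧ LDiv g h ∧ ∀ ⦃w' : C⦄ (h' : x ⟶ w'), LDiv f h' → LDiv g h' → LDiv h h'

/-- `X` is closed under right-lcm. -/
def ClosedUnderRightLcm (X : MorphismProperty C) : Prop :=
  ∀ ⦃x y y' w : C⦄ (f : x ⟶ y) (g : x ⟶ y') (h : x ⟶ w), X f → X g →
    IsRightLcm f g h → X h

/-- `C` is right-Noetherian: proper right-divisibility is well-founded. -/
def RightNoetherian (C : Type u) [Category.{v} C] : Prop :=
  WellFounded (fun a b : Σ (x : C) (y : C), x ⟶ y =>
    ∃ (e : a.2.1 = b.2.1) (g' : b.1 ⟶ a.1), ¬ IsIso g' ∧ g' ≫ a.2.2 ≫ eqToHom e = b.2.2)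

/-- `C` is left-Noetherian: proper left-divisibility is well-founded. -/
def LeftNoetherian (C : Type u) [Category.{v} C] : Prop :=
  WellFounded (fun a b : Σ (x : C) (y : C), x ⟶ y =>
    ∃ (e : b.1 = a.1) (g' : a.2.1 ⟶ b.2.1), ¬ IsIso g' ∧ eqToHom e ≫ a.2.2 ≫ g' = b.2.2)

/-- `g` is an atom of `C`. -/
def IsAtomMor {x y : C} (g : x ⟶ y) : Prop :=
  ¬ IsIso g ∧ ∀ ⦃w : C⦄ (f : x ⟶ w) (h : w ⟶ y), f ≫ h = g → IsIso f ∨ IsIso h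

/-- The only invertible morphisms of `C` are identities. -/
def NoNontrivialInvertible (C : Type u) [Category.{v} C] : Prop :=
  ∀ ⦃x y : C⦄ (e : x ⟶ y), IsIso e → ∃ h : x = y, e = eqToHom h

/-- Deformation by invertible elements, with a connecting morphism `e` at the left end. -/
inductive DeformRel : ∀ {xf xg z : C}, (xf ⟶ xg) → Path xf z → Path xg z → Prop
  | nil (z : C) : DeformRel (𝟙 z) (.nil z) (.nil z)
  | cons {xf xg yf yg z : C} (e : xf ⟶ xg) (f : xf ⟶ yf) (g : xg ⟶ yg) (e' : yf ⟶ yg)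
      {p : Path yf z} {q : Path yg z} :
      IsIso e' → e ≫ g = f ≫ e' → DeformRel e' p q →
      DeformRel e (.cons f p) (.cons g q)
  | padF {xg yg z : C} (e : z ⟶ xg) (g : xg ⟶ yg) (e' : z ⟶ yg) {q : Path yg z} :
      IsIso e' → e ≫ g = e' → DeformRel e' (.nil z) q →
      DeformRel e (.nil z) (.cons g q)
  | padG {xf yf z : C} (e : xf ⟶ z) (f : xf ⟶ yf) (e' : yf ⟶ z) {p : Path yf z} :
      IsIso e' → e = f ≫ e' → DeformRel e' p (.nil z) →
      DeformRel e (.cons f p) (.nil z)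

/-- `p` is a `C×`-deformation of `q`. -/
def IsDeformation {x z : C} (p q : Path x z) : Prop :=
  DeformRel (𝟙 x) p q

theorem LDiv.trans {x y z w : C} {f : x ⟶ y} {g : x ⟶ z} {h : x ⟶ w}
    (hfg : LDiv f g) (hgh : LDiv g h) : LDiv f h := by
  obtain ⟨r, rfl⟩ := hfg
  obtain ⟨s, rfl⟩ := hgh
  exact ⟨r ≫ s, by simp⟩

theorem LDiv.comp_left {x y z w : C} (f : x ⟶ y) {g : y ⟶ z} {h : y ⟶ w}
    (hgh : LDiv g h) : LDiv (f ≫ g) (f ≫ h) := by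
  obtain ⟨r, rfl⟩ := hgh
  exact ⟨r, by simp⟩

theorem LDiv.of_comp_left (hC : LeftCancellative C) {x y z w : C} {f : x ⟶ y} {g : y ⟶ z}
    {h : y ⟶ w} (hgh : LDiv (f ≫ g) (f ≫ h)) : LDiv g h := by
  obtain ⟨r, hr⟩ := hgh
  exact ⟨r, hC f _ _ (by simpa using hr)⟩

/-- In a left-cancellative category, a morphism with a right inverse is invertible. -/
theorem LeftCancellative.isIso_of_comp_eq_id (hC : LeftCancellative C) {x y : C}
    {a : x ⟶ y} {r : y ⟶ x} (h : a ≫ r = 𝟙 x) : IsIso a :=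
  ⟨r, h, hC a _ _ (by rw [← Category.assoc, h]; simp)⟩

theorem LeftCancellative.isIso_of_lDiv (hC : LeftCancellative C) {x y z : C}
    {f : x ⟶ y} {a : y ⟶ z} (h : LDiv (f ≫ a) f) : IsIso a := by
  obtain ⟨r, hr⟩ := h
  exact hC.isIso_of_comp_eq_id (r := r) (hC f _ _ (by simpa using hr))

theorem Sharp.of_isIso (S : MorphismProperty C) {x y : C} {g : x ⟶ y} (hg : IsIso g) :
    Sharp S g := Or.inr hg

theorem Sharp.of_mem {S : MorphismProperty C} {x y : C} {g : x ⟶ y} (hg : S g) :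
    Sharp S g := Or.inl ⟨y, g, 𝟙 y, hg, inferInstance, Category.comp_id g⟩

theorem Sharp.comp_isIso {S : MorphismProperty C} {x y z : C} {g : x ⟶ y} {e : y ⟶ z}
    (hg : Sharp S g) (he : IsIso e) : Sharp S (g ≫ e) := by
  rcases hg with ⟨w, s, e', hs, he', rfl⟩ | hg
  · exact Or.inl ⟨w, s, e' ≫ e, hs, inferInstance, by simp⟩
  · exact Or.inr inferInstance

/-- A greedy pair is also greedy with respect to `S♯`. -/
theorem Greedy2.sharp {S : MorphismProperty C} {x y z : C} {g₁ : x ⟶ y} {g₂ : y ⟶ z}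
    (hg : Greedy2 S g₁ g₂) : Greedy2 (Sharp S) g₁ g₂ := by
  rintro u w f h (⟨v, s, e, hs, he, rfl⟩ | hh) hd
  · obtain ⟨r, hr⟩ := hg f s hs (LDiv.trans ⟨e, rfl⟩ hd)
    exact ⟨inv e ≫ r, by simpa using hr⟩
  · exact ⟨inv h ≫ f ≫ g₁, by simp⟩

/-- Every element of `S♯` that left-divides `f` followed by a greedy path already left-divides
`f` followed by the first entry of the path. -/
theorem Path.GreedyFrom.lDiv {S : MorphismProperty C} {y z : C} (p : Path y z) :
    ∀ {u x w : C} {g : x ⟶ y} (f : u ⟶ x) (h : u ⟶ w), p.GreedyFrom S g → Sharp S h →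
      LDiv h (f ≫ g ≫ p.comp) → LDiv h (f ≫ g) := by
  induction p with
  | nil x =>
    intro u x w g f h _ _ hd
    simpa [Path.comp] using hd
  | cons g' p ih =>
    intro u x w g f h hp hh hd
    have hd' := ih (f ≫ g) h hp.2 hh (by simpa [Path.comp] using hd)
    exact hp.1.sharp f h hh (by simpa using hd')

/-- With respect to a Garside family, every morphism is the composite of an element of `S♯` and
a remainder, where the former is divisible by every element of `S♯` dividing the whole, even
after left-multiplication. -/
theorem IsGarside.exists_head {S : MorphismProperty C} (hS : IsGarside S) {x z : C}
    (g : x ⟶ z) : ∃ (y : C) (g₁ : x ⟶ y) (a : y ⟶ z), Sharp S g₁ ∧ g₁ ≫ a = g ∧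
      ∀ ⦃u w : C⦄ (f : u ⟶ x) (h : u ⟶ w), Sharp S h → LDiv h (f ≫ g) →
        LDiv h (f ≫ g₁) := by
  obtain ⟨p, ⟨hgr, hent⟩, rfl⟩ := hS g
  cases p with
  | nil => exact ⟨x, 𝟙 x, 𝟙 x, Sharp.of_isIso S inferInstance, by simp [Path.comp],
      fun _ _ _ _ _ hd => hd⟩
  | cons g₁ p =>
    exact ⟨_, g₁, p.comp, hent.1, rfl, fun _ _ f h hh hd => Path.GreedyFrom.lDiv p f h hgr hh hd⟩

theorem IsGarside.generates {S : MorphismProperty C} (hS : IsGarside S) :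
    Generates (Sharp S) := fun _ _ g =>
  let ⟨p, hp, hg⟩ := hS g
  ⟨p, hp.2, hg⟩

theorem IsGarside.closedUnderRightLcm (hC : LeftCancellative C) {S : MorphismProperty C}
    (hS : IsGarside S) : ClosedUnderRightLcm (Sharp S) := by
  intro x y y' w f g h hf hg ⟨hfh, hgh, hmin⟩
  obtain ⟨v, h₁, a, hh₁, rfl, hhead⟩ := hS.exists_head h
  have hd : ∀ ⦃v' : C⦄ (k : x ⟶ v'), Sharp S k → LDiv k (h₁ ≫ a) → LDiv k h₁ :=
    fun v' k hk hkd => by simpa using hhead (𝟙 x) k hk (by simpa using hkd)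
  exact hh₁.comp_isIso (hC.isIso_of_lDiv (hmin h₁ (hd f hf hfh) (hd g hg hgh)))

theorem IsGarside.closedUnderRightDivisor (hC : LeftCancellative C) {S : MorphismProperty C}
    (hS : IsGarside S) : ClosedUnderRightDivisor (Sharp S) := by
  intro x y z f g hfg
  obtain ⟨v, g₁, a, hg₁, rfl, hhead⟩ := hS.exists_head g
  have hd := hhead f _ hfg ⟨𝟙 z, by simp⟩
  rw [← Category.assoc] at hd
  exact hg₁.comp_isIso (hC.isIso_of_lDiv hd)

/-- The hypothesis that common right-multiples yield right-lcms. -/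
def HasConditionalRightLcms (C : Type u) [Category.{v} C] : Prop :=
  ∀ ⦃x y y' : C⦄ (f : x ⟶ y) (g : x ⟶ y'),
    (∃ (w : C) (h : x ⟶ w), LDiv f h ∧ LDiv g h) → ∃ (w : C) (h : x ⟶ w), IsRightLcm f g h

theorem exists_isHead (hC : LeftCancellative C) (hN : RightNoetherian C)
    (hlcm : HasConditionalRightLcms C) {X : MorphismProperty C} (hX : ClosedUnderRightLcm X)
    (hid : ∀ x : C, X (𝟙 x)) {x z : C} (g : x ⟶ z) :
    ∃ (y : C) (g₁ : x ⟶ y), IsHead X g₁ g := by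
  obtain ⟨⟨y, z', r⟩, ⟨h, e, hh, hr⟩, hmin⟩ := WellFounded.has_min hN
    {m | ∃ (h : x ⟶ m.1) (e : m.2.1 = z), X h ∧ h ≫ m.2.2 ≫ eqToHom e = g}
    ⟨⟨x, z, g⟩, 𝟙 x, rfl, hid x, by simp⟩
  dsimp only at h e hh hr
  subst e
  simp only [eqToHom_refl, Category.comp_id] at hr
  subst hr
  refine ⟨y, h, hh, ⟨r, rfl⟩, fun w' h' hh' hd => ?_⟩
  obtain ⟨w, k, hk⟩ := hlcm h h' ⟨_, h ≫ r, ⟨r, rfl⟩, hd⟩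
  have hXk := hX h h' k hh hh' hk
  obtain ⟨s, hs⟩ := hk.2.2 (h ≫ r) ⟨r, rfl⟩ hd
  obtain ⟨⟨t, rfl⟩, hk', -⟩ := hk
  have hts : t ≫ s = r := hC h _ _ (by simpa using hs)
  have ht : IsIso t := by
    by_contra ht
    exact hmin ⟨w, z', s⟩ ⟨h ≫ t, rfl, hXk, by simp [hts]⟩ ⟨rfl, t, ht, by simpa using hts⟩
  exact hk'.trans ⟨inv t, by simp⟩

/-- Left-division of a composite by an element of `X` can be transferred to the second factor. -/
theorem exists_lDiv_right_factor (hC : LeftCancellative C) (hlcm : HasConditionalRightLcms C)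
    {X : MorphismProperty C} (hX : ClosedUnderRightLcm X) (hX' : ClosedUnderRightDivisor X)
    {u x : C} (p : Path u x) (hp : p.Entries X) {w z : C} (h : u ⟶ w) (hh : X h)
    (g : x ⟶ z) (hd : LDiv h (p.comp ≫ g)) :
    ∃ (w' : C) (h' : x ⟶ w'), X h' ∧ LDiv h' g ∧ LDiv h (p.comp ≫ h') := by
  induction p generalizing w with
  | nil x => exact ⟨w, h, hh, by simpa [Path.comp] using hd, 𝟙 w, by simp [Path.comp]⟩
  | cons t p ih =>
    simp only [Path.comp, Category.assoc] at hd ⊢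
    have htd : LDiv t (t ≫ p.comp ≫ g) := ⟨_, rfl⟩
    obtain ⟨v, k, hk⟩ := hlcm h t ⟨_, _, hd, htd⟩
    have hXk := hX h t k hh hp.1 hk
    have hkd := hk.2.2 _ hd htd
    obtain ⟨hhk, ⟨h₁, rfl⟩, -⟩ := hk
    obtain ⟨w', h', hXh', hh'g, hh₁⟩ := ih hp.2 h₁ (hX' t h₁ hXk) g (hkd.of_comp_left hC)
    exact ⟨w', h', hXh', hh'g, hhk.trans (hh₁.comp_left t)⟩

/-- If all elements of `X` dividing a composite of elements of `X` are invertible, so is the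
composite. -/
theorem Path.isIso_comp {X : MorphismProperty C} (hX' : ClosedUnderRightDivisor X)
    {x z : C} (p : Path x z) (hp : p.Entries X)
    (h : ∀ ⦃y : C⦄ (t : x ⟶ y), X t → LDiv t p.comp → IsIso t) : IsIso p.comp := by
  induction p with
  | nil x => exact inferInstanceAs (IsIso (𝟙 x))
  | cons t p ih =>
    have ht : IsIso t := h t hp.1 ⟨_, rfl⟩
    have hpc : IsIso p.comp := by
      refine ih hp.2 fun y s hs hsd => ?_
      have hts : IsIso (t ≫ s) := h (t ≫ s) (hX' (inv t) _ (by simpa using hs))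
        (hsd.comp_left t)
      exact IsIso.of_isIso_comp_left t s
    exact inferInstanceAs (IsIso (t ≫ p.comp))

theorem Greedy2.of_isHead (hC : LeftCancellative C) (hlcm : HasConditionalRightLcms C)
    {S : MorphismProperty C} (hgen : Generates (Sharp S)) (hX : ClosedUnderRightLcm (Sharp S))
    (hX' : ClosedUnderRightDivisor (Sharp S)) {x y z w : C} {g₁ : x ⟶ y} {g₂ : y ⟶ z}
    {g : x ⟶ w} (hg₁ : IsHead (Sharp S) g₁ g) (hd : LDiv (g₁ ≫ g₂) g) : Greedy2 S g₁ g₂ := by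
  intro u w f h hh hhd
  obtain ⟨p, hp, rfl⟩ := hgen f
  obtain ⟨w', h', hh', hh'd, hhh'⟩ :=
    exists_lDiv_right_factor hC hlcm hX hX' p hp h (Sharp.of_mem hh) _ hhd
  exact hhh'.trans ((hg₁.2.2 h' hh' (hh'd.trans hd)).comp_left _)

theorem isGarside_of_generates_of_closed (hC : LeftCancellative C) (hN : RightNoetherian C)
    (hlcm : HasConditionalRightLcms C) {S : MorphismProperty C} (hgen : Generates (Sharp S))
    (hX : ClosedUnderRightLcm (Sharp S)) (hX' : ClosedUnderRightDivisor (Sharp S)) :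
    IsGarside S := by
  suffices H : ∀ m : Σ (x : C) (y : C), x ⟶ y, ∃ p : Path m.1 m.2.1, IsNormalDecomp S m.2.2 p from
    fun x z g => H ⟨x, z, g⟩
  intro m
  induction m using WellFounded.induction hN with
  | _ m ih =>
    obtain ⟨x, z, g⟩ := m
    dsimp only
    by_cases hg : IsIso g
    · exact ⟨.cons g (.nil z), ⟨trivial, Sharp.of_isIso S hg, trivial⟩, Category.comp_id g⟩
    obtain ⟨y, g₁, hg₁⟩ := exists_isHead hC hN hlcm hX
      (fun x => Sharp.of_isIso S inferInstance) g
    obtain ⟨r, hr⟩ := hg₁.2.1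
    have hg₁' : ¬ IsIso g₁ := by
      intro hiso
      obtain ⟨p, hp, rfl⟩ := hgen g
      refine hg (p.isIso_comp hX' hp fun y' t ht htd => ?_)
      obtain ⟨s, hs⟩ := hg₁.2.2 t ht htd
      exact hC.isIso_of_comp_eq_id (r := s ≫ inv g₁) (by rw [← Category.assoc, hs]; simp)
    obtain ⟨p, ⟨hgr, hent⟩, hp⟩ := ih ⟨y, z, r⟩ ⟨rfl, g₁, hg₁', by simpa using hr⟩
    dsimp only at p hgr hent hp
    refine ⟨.cons g₁ p, ⟨?_, hg₁.1, hent⟩, by simp [Path.comp, hp, hr]⟩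
    cases p with
    | nil => trivial
    | cons g₂ p =>
      refine ⟨Greedy2.of_isHead hC hlcm hgen hX hX' hg₁ ⟨p.comp, ?_⟩, hgr⟩
      simpa [← hp, Path.comp] using hr

theorem stmt14 {C : Type u} [Category.{v} C] (hC : LeftCancellative C)
    (hN : RightNoetherian C)
    (hlcm : ∀ ⦃x y y' : C⦄ (f : x ⟶ y) (g : x ⟶ y'),
      (∃ (w : C) (h : x ⟶ w), LDiv f h ∧ LDiv g h) →
      ∃ (w : C) (h : x ⟶ w), IsRightLcm f g h)
    (S : MorphismProperty C) :
    IsGarside S ↔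
      (Generates (Sharp S) ∧ ClosedUnderRightLcm (Sharp S) ∧
        ClosedUnderRightDivisor (Sharp S)) :=
  ⟨fun hS => ⟨hS.generates, hS.closedUnderRightLcm hC, hS.closedUnderRightDivisor hC⟩,
    fun ⟨hgen, hX, hX'⟩ => isGarside_of_generates_of_closed hC hN hlcm hgen hX hX'⟩

end GarsideTest
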